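/- arXiv:1907.11518 — 5 statements merged into one kernel-verified Lean document; each statement's English description precedes it below -/
import Mathlib

section
/- (Theorem 1, sum-rate capacity and path independence.) Let K ≥ 1, let g ∈ ℝ^K have g_k > 0 for all k, let σ² > 0, and let v : [0,1] → ℝ^K be continuously differentiable with σ² + Σ_{i=1}^K g_i v_i(t) > 0 for all t, v(0) = (1,…,1) and v(1) = (0,…,0). Define the rate of user k along v by R_k(v) := −∫_0^1 g_k v_k'(t) / (σ² + Σ_{i=1}^K g_i v_i(t)) dt. Then the sum-rate satisfies Σ_{k=1}^K R_k(v) = log(1 + (Σ_{k=1}^K g_k)/σ²), i.e. it equals the multiuser Shannon sum-rate capacity for every such path. -/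
open MeasureTheory intervalIntegral

/-- Theorem 1: for any C¹ decoding path from all-ones MSE to all-zeros MSE,
the IDMA sum-rate equals the multiuser Shannon sum-rate capacity,
independently of the path. -/
theorem idma_sum_rate_is_capacity
    (K : ℕ) (hK : 1 ≤ K) (g : Fin K → ℝ) (hg : ∀ k, 0 < g k)
    (σ2 : ℝ) (hσ : 0 < σ2)
    (v v' : ℝ → Fin K → ℝ)
    (hderiv : ∀ k, ∀ t ∈ Set.Icc (0:ℝ) 1, HasDerivAt (fun s => v s k) (v' t k) t)
    (hcont : ∀ k, ContinuousOn (fun t => v' t k) (Set.Icc (0:ℝ) 1))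
    (hpos : ∀ t ∈ Set.Icc (0:ℝ) 1, 0 < σ2 + ∑ i, g i * v t i)
    (hstart : ∀ k, v 0 k = 1) (hend : ∀ k, v 1 k = 0) :
    ∑ k, (-∫ t in (0:ℝ)..1, g k * v' t k / (σ2 + ∑ i, g i * v t i))
      = Real.log (1 + (∑ k, g k) / σ2) := by
  have hIcc : Set.uIcc (0 : ℝ) 1 = Set.Icc 0 1 := Set.uIcc_of_le zero_le_one
  have hsum : ∀ t ∈ Set.Icc (0 : ℝ) 1,
      HasDerivAt (fun s => σ2 + ∑ i, g i * v s i) (∑ i, g i * v' t i) t := fun t ht =>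
    (HasDerivAt.fun_sum fun i _ => (hderiv i t ht).const_mul (g i)).const_add σ2
  have hsum_cont : ContinuousOn (fun t => σ2 + ∑ i, g i * v t i) (Set.Icc 0 1) :=
    fun t ht => (hsum t ht).continuousAt.continuousWithinAt
  have hint : ∀ k, IntervalIntegrable
      (fun t => g k * v' t k / (σ2 + ∑ i, g i * v t i)) volume 0 1 := fun k =>
    ContinuousOn.intervalIntegrable <| hIcc ▸
      (continuousOn_const.mul (hcont k)).div hsum_cont fun t ht => (hpos t ht).ne'
  have hsum_div : ∀ t, ∑ k, g k * v' t k / (σ2 + ∑ i, g i * v t i)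
      = (∑ k, g k * v' t k) / (σ2 + ∑ i, g i * v t i) := fun t => (Finset.sum_div _ _ _).symm
  have hFTC : ∫ t in (0 : ℝ)..1, ∑ k, g k * v' t k / (σ2 + ∑ i, g i * v t i)
      = Real.log (σ2 + ∑ i, g i * v 1 i) - Real.log (σ2 + ∑ i, g i * v 0 i) := by
    refine integral_eq_sub_of_hasDerivAt (f := fun t => Real.log (σ2 + ∑ i, g i * v t i))
      (fun t ht => ?_) ?_
    · rw [hIcc] at ht
      rw [hsum_div]
      exact (hsum t ht).log (hpos t ht).ne'
    · simpa only [Finset.sum_fn] using IntervalIntegrable.sum Finset.univ fun k _ => hint k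
  have hgsum : 0 ≤ ∑ k, g k := Finset.sum_nonneg fun k _ => (hg k).le
  rw [Finset.sum_neg_distrib, ← integral_finsetSum fun k _ => hint k, hFTC]
  simp only [hstart, hend, mul_one, mul_zero, Finset.sum_const_zero, add_zero, neg_sub]
  rw [← Real.log_div (by positivity) hσ.ne', add_div, div_self hσ.ne']
end

section
/- (Appendix A identity.) Let K ≥ 1, let g ∈ ℝ^K have g_k > 0 for all k, let σ² > 0, and let v : [0,1] → [0,1]^K be continuously differentiable with v(0) = (1,…,1) and v(1) = (0,…,0). Fix k and define the ESE output SNR ρ_k(t) := g_k / (σ² + Σ_{i≠k} g_i v_i(t)). Then ∫_0^1 ρ_k'(t) v_k(t) / (1 + ρ_k(t) v_k(t)) dt + log(1 + ρ_k(0)) = −∫_0^1 g_k v_k'(t) / (σ² + Σ_{i=1}^K g_i v_i(t)) dt; that is, the achievable-rate integral over SNR of the matched decoder equals the MSE-field line integral −∫_{v_k=1}^{v_k=0} g_k/(gᵀv + σ²) dv_k. -/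
open MeasureTheory intervalIntegral

/-- Appendix A identity: the achievable-rate integral over the SNR of the
matched decoder (with Gaussian MMSE integrand `v/(1+ρv) = 1/(ρ + v⁻¹)`)
equals the MSE-field line integral `−∫ g_k/(gᵀv + σ²) dv_k`. -/
theorem appendix_a_rate_identity
    (K : ℕ) (hK : 1 ≤ K) (g : Fin K → ℝ) (hg : ∀ k, 0 < g k)
    (σ2 : ℝ) (hσ : 0 < σ2)
    (v v' : ℝ → Fin K → ℝ)
    (hrange : ∀ k, ∀ t ∈ Set.Icc (0:ℝ) 1, v t k ∈ Set.Icc (0:ℝ) 1)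
    (hderiv : ∀ k, ∀ t ∈ Set.Icc (0:ℝ) 1, HasDerivAt (fun s => v s k) (v' t k) t)
    (hcont : ∀ k, ContinuousOn (fun t => v' t k) (Set.Icc (0:ℝ) 1))
    (hstart : ∀ k, v 0 k = 1) (hend : ∀ k, v 1 k = 0)
    (k : Fin K) (ρ ρ' : ℝ → ℝ)
    (hρ : ∀ t, ρ t = g k / (σ2 + ∑ i ∈ Finset.univ.erase k, g i * v t i))
    (hρderiv : ∀ t ∈ Set.Icc (0:ℝ) 1, HasDerivAt ρ (ρ' t) t)
    (hρcont : ContinuousOn ρ' (Set.Icc (0:ℝ) 1)) :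
    (∫ t in (0:ℝ)..1, ρ' t * v t k / (1 + ρ t * v t k)) + Real.log (1 + ρ 0)
      = -∫ t in (0:ℝ)..1, g k * v' t k / (σ2 + ∑ i, g i * v t i) := by
  have hv : ∀ i, ContinuousOn (fun t => v t i) (Set.Icc (0:ℝ) 1) := fun i t ht =>
    (hderiv i t ht).continuousAt.continuousWithinAt
  have hρc : ContinuousOn ρ (Set.Icc (0:ℝ) 1) := fun t ht =>
    (hρderiv t ht).continuousAt.continuousWithinAt
  have hD : ∀ t ∈ Set.Icc (0:ℝ) 1, 0 < σ2 + ∑ i ∈ Finset.univ.erase k, g i * v t i :=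
    fun t ht => add_pos_of_pos_of_nonneg hσ
      (Finset.sum_nonneg fun i _ => mul_nonneg (hg i).le (hrange i t ht).1)
  have hρpos : ∀ t ∈ Set.Icc (0:ℝ) 1, 0 < ρ t := fun t ht => by
    rw [hρ]
    exact div_pos (hg k) (hD t ht)
  have hpos : ∀ t ∈ Set.Icc (0:ℝ) 1, 0 < 1 + ρ t * v t k := fun t ht =>
    add_pos_of_pos_of_nonneg one_pos (mul_nonneg (hρpos t ht).le (hrange k t ht).1)
  have hden : ContinuousOn (fun t => 1 + ρ t * v t k) (Set.Icc (0:ℝ) 1) :=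
    continuousOn_const.add (hρc.mul (hv k))
  have hint₁ : IntervalIntegrable (fun t => ρ' t * v t k / (1 + ρ t * v t k)) volume 0 1 :=
    ((hρcont.mul (hv k)).div hden fun t ht => (hpos t ht).ne').intervalIntegrable_of_Icc
      zero_le_one
  have hint₂ : IntervalIntegrable (fun t => ρ t * v' t k / (1 + ρ t * v t k)) volume 0 1 :=
    ((hρc.mul (hcont k)).div hden fun t ht => (hpos t ht).ne').intervalIntegrable_of_Icc
      zero_le_one
  have hfield : ∫ t in (0:ℝ)..1, g k * v' t k / (σ2 + ∑ i, g i * v t i)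
      = ∫ t in (0:ℝ)..1, ρ t * v' t k / (1 + ρ t * v t k) := by
    refine integral_congr fun t ht => ?_
    rw [Set.uIcc_of_le zero_le_one] at ht
    have hDt := hD t ht
    have hgv : 0 ≤ g k * v t k := mul_nonneg (hg k).le (hrange k t ht).1
    simp only [hρ t, ← Finset.add_sum_erase Finset.univ (fun i => g i * v t i)
      (Finset.mem_univ k)]
    generalize ∑ i ∈ Finset.univ.erase k, g i * v t i = S at hDt
    have hsum : σ2 + (g k * v t k + S) ≠ 0 := by linarith
    have hone : 1 + g k / (σ2 + S) * v t k = (σ2 + (g k * v t k + S)) / (σ2 + S) := by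
      field_simp
      ring
    rw [hone]
    field_simp
  have hlog : ∫ t in (0:ℝ)..1, (ρ' t * v t k / (1 + ρ t * v t k)
      + ρ t * v' t k / (1 + ρ t * v t k)) = -Real.log (1 + ρ 0) := by
    rw [integral_eq_sub_of_hasDerivAt (f := fun t => Real.log (1 + ρ t * v t k)) _
      (hint₁.add hint₂)]
    · simp [hstart, hend]
    · intro t ht
      rw [Set.uIcc_of_le zero_le_one] at ht
      rw [← add_div]
      exact (((hρderiv t ht).mul (hderiv k t ht)).const_add 1).log (hpos t ht).ne'
  rw [integral_add hint₁ hint₂] at hlog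
  rw [hfield]
  linarith
end

section
/- (Straight-line path.) Let K ≥ 1, let g ∈ ℝ^K have g_k > 0 for all k, let σ² > 0, and let v : [0,1] → ℝ^K be the straight-line path v(t) = (1−t)·(1,…,1). Then for every k, the rate of user k along v satisfies R_k(v) := −∫_0^1 g_k v_k'(t) / (σ² + Σ_{i=1}^K g_i v_i(t)) dt = (g_k / Σ_{l=1}^K g_l) · log(1 + (Σ_{l=1}^K g_l)/σ²); i.e. each user's rate is proportional to its received power g_k. -/
open MeasureTheory intervalIntegral

/-- The integral of `a * (-1) / (c + s * (1 - t))` over `[0, 1]`, by the fundamental theorem of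
calculus. -/
theorem integral_mul_neg_one_div_add_mul_one_sub (a : ℝ) {c s : ℝ} (hc : 0 < c) (hs : 0 < s) :
    ∫ t in (0:ℝ)..1, a * (-1) / (c + s * (1 - t)) = -((a / s) * Real.log (1 + s / c)) := by
  have hpos : ∀ t ∈ Set.uIcc (0:ℝ) 1, c + s * (1 - t) ≠ 0 := by
    intro t ht
    rw [Set.uIcc_of_le zero_le_one] at ht
    have := mul_nonneg hs.le (sub_nonneg.2 ht.2)
    positivity
  have hderiv : ∀ t ∈ Set.uIcc (0:ℝ) 1,
      HasDerivAt (fun t => (a / s) * Real.log (c + s * (1 - t)))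
        (a * (-1) / (c + s * (1 - t))) t := by
    intro t ht
    have hne := hpos t ht
    refine (((((hasDerivAt_id' t).const_sub 1).const_mul s).const_add c).log hne
      |>.const_mul (a / s)).congr_deriv ?_
    field_simp
  rw [integral_eq_sub_of_hasDerivAt hderiv
    (ContinuousOn.intervalIntegrable (by fun_prop (disch := assumption))),
    show 1 + s / c = (c + s) / c by field_simp, Real.log_div (by positivity) hc.ne']
  simp only [sub_self, mul_zero, add_zero, sub_zero, mul_one]
  ring

/-- Straight-line decoding path `v(t) = (1−t)·(1,…,1)`: each user's rate is
proportional to its received power `g_k`. -/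
theorem straight_line_path_rate
    (K : ℕ) (hK : 1 ≤ K) (g : Fin K → ℝ) (hg : ∀ k, 0 < g k)
    (σ2 : ℝ) (hσ : 0 < σ2) (k : Fin K) :
    -∫ t in (0:ℝ)..1, g k * (-1) / (σ2 + ∑ i, g i * (1 - t))
      = (g k / ∑ l, g l) * Real.log (1 + (∑ l, g l) / σ2) := by
  have hs : 0 < ∑ l, g l := Finset.sum_pos (fun i _ => hg i) ⟨k, Finset.mem_univ k⟩
  simp_rw [← Finset.sum_mul]
  rw [integral_mul_neg_one_div_add_mul_one_sub (g k) hσ hs, neg_neg]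
end

section
/- (Subset-sum rate bound, Appendix B.) Let K ≥ 1, let g ∈ ℝ^K have g_k > 0 for all k, let σ² > 0, and let v : [0,1] → [0,1]^K be continuously differentiable with v(0) = (1,…,1), v(1) = (0,…,0), and with every component v_l nonincreasing. Then for every nonempty subset S ⊆ {1,…,K}, Σ_{k∈S} R_k(v) ≤ log(1 + (Σ_{k∈S} g_k)/σ²), where R_k(v) := −∫_0^1 g_k v_k'(t) / (σ² + Σ_{i=1}^K g_i v_i(t)) dt. Hence every rate tuple achievable along such a path lies in the K-user Gaussian MAC capacity region. -/
open MeasureTheory intervalIntegral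

/-- Subset-sum rate bound (Appendix B): along any C¹, componentwise
nonincreasing decoding path from all-ones to all-zeros, for every nonempty
subset `S` of users the sum of their rates is at most
`log(1 + (Σ_{k∈S} g_k)/σ²)`; hence every achievable rate tuple lies in the
K-user Gaussian MAC capacity region. -/
theorem subset_sum_rate_bound
    (K : ℕ) (hK : 1 ≤ K) (g : Fin K → ℝ) (hg : ∀ k, 0 < g k)
    (σ2 : ℝ) (hσ : 0 < σ2)
    (v v' : ℝ → Fin K → ℝ)
    (hrange : ∀ l, ∀ t ∈ Set.Icc (0:ℝ) 1, v t l ∈ Set.Icc (0:ℝ) 1)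
    (hderiv : ∀ l, ∀ t ∈ Set.Icc (0:ℝ) 1, HasDerivAt (fun s => v s l) (v' t l) t)
    (hcont : ∀ l, ContinuousOn (fun t => v' t l) (Set.Icc (0:ℝ) 1))
    (hstart : ∀ l, v 0 l = 1) (hend : ∀ l, v 1 l = 0)
    (hmono : ∀ l, ∀ t ∈ Set.Icc (0:ℝ) 1, v' t l ≤ 0)
    (S : Finset (Fin K)) (hS : S.Nonempty) :
    ∑ k ∈ S, (-∫ t in (0:ℝ)..1, g k * v' t k / (σ2 + ∑ i, g i * v t i))
      ≤ Real.log (1 + (∑ k ∈ S, g k) / σ2) := by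
  have h01 : Set.uIcc (0:ℝ) 1 = Set.Icc 0 1 := Set.uIcc_of_le zero_le_one
  have hvcont : ∀ l, ContinuousOn (fun t => v t l) (Set.Icc (0:ℝ) 1) := fun l t ht =>
    (hderiv l t ht).continuousAt.continuousWithinAt
  have hpart : ∀ T : Finset (Fin K), ∀ t ∈ Set.Icc (0:ℝ) 1, 0 < σ2 + ∑ i ∈ T, g i * v t i :=
    fun T t ht => add_pos_of_pos_of_nonneg hσ
      (Finset.sum_nonneg fun i _ => mul_nonneg (hg i).le (hrange i t ht).1)
  have hpartcont : ∀ T : Finset (Fin K),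
      ContinuousOn (fun t => σ2 + ∑ i ∈ T, g i * v t i) (Set.Icc (0:ℝ) 1) := fun T =>
    continuousOn_const.add (continuousOn_finsetSum T fun i _ => continuousOn_const.mul (hvcont i))
  have hint : ∀ (T : Finset (Fin K)) (k : Fin K),
      IntervalIntegrable (fun t => g k * v' t k / (σ2 + ∑ i ∈ T, g i * v t i)) volume 0 1 := by
    intro T k
    refine ContinuousOn.intervalIntegrable ?_
    rw [h01]
    exact (continuousOn_const.mul (hcont k)).div (hpartcont T) fun t ht => (hpart T t ht).ne'
  have hlog : ∫ t in (0:ℝ)..1, ∑ k ∈ S, g k * v' t k / (σ2 + ∑ i ∈ S, g i * v t i)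
      = Real.log σ2 - Real.log (σ2 + ∑ k ∈ S, g k) := by
    rw [integral_eq_sub_of_hasDerivAt (f := fun t => Real.log (σ2 + ∑ i ∈ S, g i * v t i))]
    · simp [hstart, hend]
    · intro t ht
      rw [h01] at ht
      rw [← Finset.sum_div]
      exact ((HasDerivAt.fun_sum fun i _ => (hderiv i t ht).const_mul (g i)).const_add σ2).log
        (hpart S t ht).ne'
    · simpa only [Finset.sum_fn] using IntervalIntegrable.sum S fun k _ => hint S k
  have hlogdiv : Real.log (1 + (∑ k ∈ S, g k) / σ2)
      = Real.log (σ2 + ∑ k ∈ S, g k) - Real.log σ2 := by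
    have hsum : 0 ≤ ∑ k ∈ S, g k := Finset.sum_nonneg fun k _ => (hg k).le
    rw [← Real.log_div (by positivity) hσ.ne', add_div, div_self hσ.ne']
  rw [hlogdiv, ← neg_sub, ← hlog, integral_finsetSum fun k _ => hint S k, ← Finset.sum_neg_distrib]
  refine Finset.sum_le_sum fun k _ => neg_le_neg ?_
  refine integral_mono_on zero_le_one (hint S k) (hint Finset.univ k) fun t ht => ?_
  have hle : σ2 + ∑ i ∈ S, g i * v t i ≤ σ2 + ∑ i, g i * v t i := by
    gcongr
    · exact fun i _ _ => mul_nonneg (hg i).le (hrange i t ht).1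
    · exact Finset.subset_univ S
  have hnum : 0 ≤ -(g k * v' t k) :=
    neg_nonneg.2 (mul_nonpos_of_nonneg_of_nonpos (hg k).le (hmono k t ht))
  have hquot := div_le_div_of_nonneg_left hnum (hpart S t ht) hle
  rwa [neg_div, neg_div, neg_le_neg_iff] at hquot
end

section
/- (Theorem 2, achievability of the dominant face.) Let K ≥ 1, let g ∈ ℝ^K have g_k > 0 for all k, and let σ² > 0. Let R ∈ ℝ^K be any rate tuple on the dominant face of the K-user Gaussian MAC capacity region, i.e. R_k ≥ 0 for all k, Σ_{k∈S} R_k ≤ log(1 + (Σ_{k∈S} g_k)/σ²) for every subset S ⊆ {1,…,K}, and Σ_{k=1}^K R_k = log(1 + (Σ_{k=1}^K g_k)/σ²). Then there exists a continuous, piecewise continuously differentiable path v : [0,1] → [0,1]^K with v(0) = (1,…,1), v(1) = (0,…,0) and every component nonincreasing, such that for every k, R_k = −∫_0^1 g_k v_k'(t) / (σ² + Σ_{i=1}^K g_i v_i(t)) dt. -/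
open MeasureTheory intervalIntegral

/-- Cutting the window `[c, c + d)` out of `p` and closing the gap removes exactly the integral
of `p` over that window. -/
theorem integral_excise {p : ℝ → ℝ} (hp : ∀ a b, IntervalIntegrable p volume a b)
    {b c d : ℝ} (hc : 0 ≤ c) (hcb : c ≤ b) :
    ∫ x in (0:ℝ)..b, (if x < c then p x else p (x + d)) =
      (∫ x in (0:ℝ)..(b + d), p x) - ∫ x in c..(c + d), p x := by
  have e₁ : Set.EqOn (fun x => if x < c then p x else p (x + d)) p (Set.Ioo 0 c) :=
    fun x hx => by simp [hx.2]
  have e₂ : Set.EqOn (fun x => if x < c then p x else p (x + d)) (fun x => p (x + d))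
      (Set.Ioo c b) := fun x hx => by simp [hx.1.le]
  have i₁ : IntervalIntegrable (fun x => if x < c then p x else p (x + d)) volume 0 c :=
    (hp 0 c).congr_uIoo fun x hx => by
      rw [Set.uIoo_of_le hc] at hx; exact (e₁ hx).symm
  have hs : IntervalIntegrable (fun x => p (x + d)) volume c b := by
    simpa using (hp (c + d) (b + d)).comp_add_right d
  have i₂ : IntervalIntegrable (fun x => if x < c then p x else p (x + d)) volume c b :=
    hs.congr_uIoo fun x hx => by
      rw [Set.uIoo_of_le hcb] at hx; exact (e₂ hx).symm
  rw [← integral_add_adjacent_intervals i₁ i₂]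
  have h₁ : ∫ x in (0:ℝ)..c, (if x < c then p x else p (x + d)) = ∫ x in (0:ℝ)..c, p x :=
    integral_congr_uIoo fun x hx => by rw [Set.uIoo_of_le hc] at hx; exact e₁ hx
  have h₂ : ∫ x in c..b, (if x < c then p x else p (x + d)) = ∫ x in c..b, p (x + d) :=
    integral_congr_uIoo fun x hx => by rw [Set.uIoo_of_le hcb] at hx; exact e₂ hx
  rw [h₁, h₂, integral_comp_add_right]
  have := integral_add_adjacent_intervals (hp 0 c) (hp c (c + d))
  have := integral_add_adjacent_intervals (hp 0 (c + d)) (hp (c + d) (b + d))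
  linarith

theorem intervalIntegrable_excise {p : ℝ → ℝ} (hp : ∀ a b, IntervalIntegrable p volume a b)
    (c d a b : ℝ) :
    IntervalIntegrable (fun x => if x < c then p x else p (x + d)) volume a b := by
  have h₂ : IntervalIntegrable (fun x => p (x + d)) volume a b := by
    simpa using (hp (a + d) (b + d)).comp_add_right d
  rw [intervalIntegrable_iff] at *
  exact Integrable.piecewise (s := {x | x < c}) measurableSet_Iio
    ((intervalIntegrable_iff.1 (hp a b)).integrable.integrableOn) h₂.integrable.integrableOn

theorem intervalIntegrable_indicator_preimage {ι : Type*} [MeasurableSpace ι]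
    [MeasurableSingletonClass ι] {u : ℝ → ι} (hu : Measurable u) {q : ℝ → ℝ}
    (hq : ∀ a b, IntervalIntegrable q volume a b) (j : ι) (a b : ℝ) :
    IntervalIntegrable ((u ⁻¹' {j}).indicator q) volume a b := by
  have h := hq a b
  rw [intervalIntegrable_iff] at *
  exact h.indicator (hu (measurableSet_singleton j))

/-- Opening a window of length `d` at `c` in the labelling `u` and giving it the label `k`. -/
noncomputable def insertLabel {ι : Type*} (u : ℝ → ι) (k : ι) (c d : ℝ) (x : ℝ) : ι :=
  if x < c then u x else if x < c + d then k else u (x - d)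

theorem measurable_insertLabel {ι : Type*} [MeasurableSpace ι] {u : ℝ → ι} (hu : Measurable u)
    (k : ι) (c d : ℝ) : Measurable (insertLabel u k c d) :=
  Measurable.ite measurableSet_Iio hu
    (Measurable.ite measurableSet_Iio measurable_const (hu.comp (measurable_id.sub_const d)))

open Classical in
theorem integral_insertLabel {ι : Type*} [MeasurableSpace ι] [MeasurableSingletonClass ι]
    {u : ℝ → ι} (hu : Measurable u) {q : ℝ → ℝ} (hq : ∀ a b, IntervalIntegrable q volume a b)
    (k j : ι) {b c d : ℝ} (hc : 0 ≤ c) (hcb : c ≤ b) (hd : 0 ≤ d) :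
    ∫ x in (0:ℝ)..(b + d), (insertLabel u k c d ⁻¹' {j}).indicator q x =
      (∫ x in (0:ℝ)..b, (u ⁻¹' {j}).indicator (fun x => if x < c then q x else q (x + d)) x) +
        if k = j then ∫ x in c..(c + d), q x else 0 := by
  have key := integral_excise (d := d) (intervalIntegrable_indicator_preimage
    (measurable_insertLabel hu k c d) hq j) hc hcb
  have e₁ : (fun x => if x < c then (insertLabel u k c d ⁻¹' {j}).indicator q x
      else (insertLabel u k c d ⁻¹' {j}).indicator q (x + d)) =
      (u ⁻¹' {j}).indicator (fun x => if x < c then q x else q (x + d)) := by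
    funext x
    by_cases hx : x < c
    · simp [Set.indicator_apply, insertLabel, hx]
    · have : ¬ x + d < c := by linarith
      simp [Set.indicator_apply, insertLabel, hx, this]
  have e₂ : ∫ x in c..(c + d), (insertLabel u k c d ⁻¹' {j}).indicator q x =
      if k = j then ∫ x in c..(c + d), q x else 0 := by
    have : ∫ x in c..(c + d), (insertLabel u k c d ⁻¹' {j}).indicator q x =
        ∫ x in c..(c + d), if k = j then q x else 0 := by
      refine integral_congr_uIoo fun x hx => ?_
      rw [Set.uIoo_of_le (by linarith)] at hx
      simp [Set.indicator_apply, insertLabel, hx.1.not_gt, hx.2]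
    rw [this]
    split_ifs <;> simp
  rw [e₁, e₂] at key
  linarith

open Filter Topology in
theorem insertLabel_eventually_const {ι : Type*} {u : ℝ → ι} {F : Finset ℝ}
    (hF : ∀ x ∉ F, ∀ᶠ y in 𝓝 x, u y = u x) (k : ι) {c d : ℝ} {x : ℝ}
    (hxF : x ∉ F) (hxd : x - d ∉ F) (hxc : x ≠ c) (hxcd : x ≠ c + d) :
    ∀ᶠ y in 𝓝 x, insertLabel u k c d y = insertLabel u k c d x := by
  rcases lt_or_gt_of_ne hxc with h | h
  · filter_upwards [hF x hxF, eventually_lt_nhds h] with y hy hyc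
    simp [insertLabel, h, hyc, hy]
  rcases lt_or_gt_of_ne hxcd with h' | h'
  · filter_upwards [eventually_gt_nhds h, eventually_lt_nhds h'] with y hy hyc
    simp [insertLabel, h.not_gt, h', hyc, hy.not_gt]
  · have ht : Tendsto (fun y : ℝ => y - d) (𝓝 x) (𝓝 (x - d)) :=
      (continuous_id.sub continuous_const).tendsto x
    filter_upwards [eventually_gt_nhds h, eventually_gt_nhds h', ht.eventually (hF _ hxd)]
      with y hy hyc hyu
    simp [insertLabel, h.not_gt, h'.not_gt, hyc.not_gt, hy.not_gt, hyu]

open Filter Topology in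
/-- If the primitive of `h` satisfies the polymatroid-type bounds `∫₀^{r(S)} h ≤ g(S)`, with
equality for `S = s`, then `[0, r(s)]` splits into finite unions of intervals, indexed by `s`,
with prescribed lengths `r` and prescribed `h`-masses `g`. -/
theorem exists_labelling {ι : Type*} [MeasurableSpace ι] [MeasurableSingletonClass ι]
    (s : Finset ι) (hs : s.Nonempty) (r g : ι → ℝ) (hr : ∀ k, 0 ≤ r k) (h : ℝ → ℝ)
    (hh : ∀ a b, IntervalIntegrable h volume a b)
    (hsub : ∀ S ⊆ s, ∫ x in (0:ℝ)..(∑ k ∈ S, r k), h x ≤ ∑ k ∈ S, g k)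
    (htot : ∫ x in (0:ℝ)..(∑ k ∈ s, r k), h x = ∑ k ∈ s, g k) :
    ∃ (u : ℝ → ι) (F : Finset ℝ), Measurable u ∧ (∀ x, u x ∈ s) ∧
      (∀ x ∉ F, ∀ᶠ y in 𝓝 x, u y = u x) ∧
      ∀ k ∈ s,
        ∫ x in (0:ℝ)..(∑ k ∈ s, r k), (u ⁻¹' {k}).indicator (fun _ => (1:ℝ)) x = r k ∧
        ∫ x in (0:ℝ)..(∑ k ∈ s, r k), (u ⁻¹' {k}).indicator h x = g k := by
  classical
  induction hs using Finset.Nonempty.cons_induction generalizing h with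
  | singleton a =>
    refine ⟨fun _ => a, ∅, measurable_const, by simp, by simp, ?_⟩
    intro k hk
    obtain rfl : k = a := by simpa using hk
    simpa using htot
  | cons k s hk hs ih =>
    simp only [Finset.sum_cons] at htot
    have hrs : 0 ≤ ∑ j ∈ s, r j := Finset.sum_nonneg fun j _ => hr j
    obtain ⟨c, ⟨hc0, hcs⟩, hc⟩ : ∃ c ∈ Set.Icc 0 (∑ j ∈ s, r j),
        ∫ x in c..(c + r k), h x = g k := by
      have hprim := continuous_primitive hh 0
      have hcont : Continuous fun c => ∫ x in c..(c + r k), h x := by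
        have : (fun c => ∫ x in c..(c + r k), h x) =
            fun c => (∫ x in (0:ℝ)..(c + r k), h x) - ∫ x in (0:ℝ)..c, h x := by
          funext c
          rw [integral_interval_sub_left (hh _ _) (hh _ _)]
        rw [this]
        exact (hprim.comp (continuous_id.add continuous_const)).sub hprim
      refine intermediate_value_Icc hrs hcont.continuousOn ⟨?_, ?_⟩
      · simpa using hsub {k} (by simp)
      · have h₁ := hsub s (Finset.subset_cons hk)
        have h₂ := integral_interval_sub_left (hh 0 (∑ j ∈ s, r j + r k)) (hh 0 (∑ j ∈ s, r j))
        rw [add_comm] at htot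
        linarith
    obtain ⟨u, F, hu, hus, hF, hint⟩ := ih (fun x => if x < c then h x else h (x + r k))
      (intervalIntegrable_excise hh c (r k)) (by
        intro S hS
        have hkS : k ∉ S := fun hkS => hk (hS hkS)
        have hS0 : 0 ≤ ∑ j ∈ S, r j := Finset.sum_nonneg fun j _ => hr j
        rcases le_total c (∑ j ∈ S, r j) with hcS | hcS
        · rw [integral_excise hh hc0 hcS, hc]
          have := hsub (Finset.cons k S hkS) (Finset.cons_subset_cons.2 hS)
          rw [Finset.sum_cons, Finset.sum_cons, add_comm (r k)] at this
          linarith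
        · refine le_trans (le_of_eq ?_) (hsub S (hS.trans (Finset.subset_cons hk)))
          refine integral_congr_uIoo fun x hx => ?_
          rw [Set.uIoo_of_le hS0] at hx
          simp [hx.2.trans_le hcS])
      (by rw [integral_excise hh hc0 hcs, hc, add_comm, htot]; ring)
    refine ⟨insertLabel u k c (r k), F ∪ F.image (· + r k) ∪ {c, c + r k},
      measurable_insertLabel hu k c _, ?_, ?_, ?_⟩
    · intro x
      simp only [insertLabel, Finset.mem_cons]
      split_ifs
      exacts [Or.inr (hus _), Or.inl rfl, Or.inr (hus _)]
    · intro x hx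
      simp only [Finset.mem_union, Finset.mem_image, Finset.mem_insert, Finset.mem_singleton,
        not_or] at hx
      exact insertLabel_eventually_const hF k hx.1.1
        (fun hm => hx.1.2 ⟨_, hm, by ring⟩) hx.2.1 hx.2.2
    · intro j hj
      rw [Finset.sum_cons, add_comm (r k), integral_insertLabel hu (by simp) k j hc0 hcs (hr k),
        integral_insertLabel hu hh k j hc0 hcs (hr k)]
      rcases Finset.mem_cons.1 hj with rfl | hj
      · have : u ⁻¹' {j} = ∅ := by
          ext x
          simpa using fun hx : u x = j => hk (hx ▸ hus x)
        simp [this, hc]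
      · have hkj : k ≠ j := fun e => hk (e ▸ hj)
        simpa [hkj] using hint j hj

theorem exists_partition_avoiding (F : Finset ℝ) :
    ∃ (n : ℕ) (s : ℕ → ℝ), s 0 = 0 ∧ s n = 1 ∧ (∀ i < n, s i < s (i + 1)) ∧
      ∀ i < n, ∀ x ∈ Set.Ioo (s i) (s (i + 1)), x ∈ Set.Ioo 0 1 ∧ x ∉ F := by
  classical
  let P : Finset ℝ := insert 0 (insert 1 (F.filter fun x => 0 < x ∧ x < 1))
  have hP : ∀ x ∈ P, 0 ≤ x ∧ x ≤ 1 := by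
    intro x hx
    simp only [P, Finset.mem_insert, Finset.mem_filter] at hx
    rcases hx with rfl | rfl | ⟨-, h₀, h₁⟩
    exacts [⟨le_rfl, zero_le_one⟩, ⟨zero_le_one, le_rfl⟩, ⟨h₀.le, h₁.le⟩]
  obtain ⟨n, hn⟩ : ∃ n, P.card = n + 1 :=
    Nat.exists_eq_succ_of_ne_zero (Finset.card_ne_zero_of_mem (a := 0) (by simp [P]))
  let e := P.orderEmbOfFin hn
  have hmem : ∀ i, e i ∈ P := P.orderEmbOfFin_mem hn
  have hsurj : ∀ x ∈ P, ∃ j, e j = x := by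
    intro x hx
    have : x ∈ Set.range e := by rw [P.range_orderEmbOfFin hn]; exact hx
    exact this
  have hfin : ∀ {i} (hi : i ≤ n), (⟨min i n, by omega⟩ : Fin (n + 1)) = ⟨i, by omega⟩ :=
    fun hi => Fin.ext (min_eq_left hi)
  refine ⟨n, fun i => e ⟨min i n, by omega⟩, ?_, ?_, ?_, ?_⟩
  · obtain ⟨j, hj⟩ := hsurj 0 (by simp [P])
    refine le_antisymm ?_ (hP _ (hmem _)).1
    rw [← hj]
    exact e.monotone (Fin.le_def.2 (by simp))
  · obtain ⟨j, hj⟩ := hsurj 1 (by simp [P])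
    refine le_antisymm (hP _ (hmem _)).2 ?_
    rw [← hj]
    refine e.monotone (Fin.le_def.2 ?_)
    simp only [min_self]
    omega
  · intro i hi
    refine e.strictMono (Fin.lt_def.2 ?_)
    simp only
    omega
  · intro i hi x hx
    have h01 : 0 < x ∧ x < 1 :=
      ⟨(hP _ (hmem _)).1.trans_lt hx.1, hx.2.trans_le (hP _ (hmem _)).2⟩
    refine ⟨h01, fun hxF => ?_⟩
    obtain ⟨j, rfl⟩ := hsurj x (by simp [P, hxF, h01])
    have h₁ := Fin.lt_def.1 (e.lt_iff_lt.1 hx.1)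
    have h₂ := Fin.lt_def.1 (e.lt_iff_lt.1 hx.2)
    simp only at h₁ h₂
    omega

open Filter Topology in
theorem continuousAt_indicator_of_eventually_const {ι : Type*} {u : ℝ → ι} {q : ℝ → ℝ} {x : ℝ}
    (hq : ContinuousAt q x) (hu : ∀ᶠ y in 𝓝 x, u y = u x) (k : ι) :
    ContinuousAt ((u ⁻¹' {k}).indicator q) x := by
  classical
  have : ContinuousAt (fun y => if u x = k then q y else 0) x := by
    split_ifs
    exacts [hq, continuousAt_const]
  refine this.congr ?_
  filter_upwards [hu] with y hy
  simp [Set.indicator_apply, hy]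

/-- Theorem 2 (achievability of the dominant face): every rate tuple on the
dominant face of the K-user Gaussian MAC capacity region is achieved by some
continuous, piecewise continuously differentiable, componentwise nonincreasing
decoding path from all-ones MSE to all-zeros MSE. -/
theorem dominant_face_achievable
    (K : ℕ) (hK : 1 ≤ K) (g : Fin K → ℝ) (hg : ∀ k, 0 < g k)
    (σ2 : ℝ) (hσ : 0 < σ2) (R : Fin K → ℝ)
    (hRnn : ∀ k, 0 ≤ R k)
    (hRsub : ∀ S : Finset (Fin K),
      ∑ k ∈ S, R k ≤ Real.log (1 + (∑ k ∈ S, g k) / σ2))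
    (hRsum : ∑ k, R k = Real.log (1 + (∑ k, g k) / σ2)) :
    ∃ (n : ℕ) (s : ℕ → ℝ) (v v' : ℝ → Fin K → ℝ),
      s 0 = 0 ∧ s n = 1 ∧ (∀ i < n, s i < s (i + 1)) ∧
      (∀ k, ContinuousOn (fun t => v t k) (Set.Icc (0:ℝ) 1)) ∧
      (∀ k, v 0 k = 1) ∧ (∀ k, v 1 k = 0) ∧
      (∀ k, ∀ t ∈ Set.Icc (0:ℝ) 1, v t k ∈ Set.Icc (0:ℝ) 1) ∧
      (∀ k, AntitoneOn (fun t => v t k) (Set.Icc (0:ℝ) 1)) ∧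
      (∀ i < n, ∀ k, ∀ t ∈ Set.Ioo (s i) (s (i + 1)),
        HasDerivAt (fun u => v u k) (v' t k) t) ∧
      (∀ i < n, ∀ k, ContinuousOn (fun t => v' t k) (Set.Ioo (s i) (s (i + 1)))) ∧
      (∀ k, R k = -∫ t in (0:ℝ)..1, g k * v' t k / (σ2 + ∑ i, g i * v t i)) := by
  classical
  have hne : (Finset.univ : Finset (Fin K)).Nonempty := ⟨⟨0, hK⟩, Finset.mem_univ _⟩
  have hexp : ∀ S : Finset (Fin K),
      σ2 * Real.exp (Real.log (1 + (∑ k ∈ S, g k) / σ2)) = σ2 + ∑ k ∈ S, g k := by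
    intro S
    have : 0 ≤ ∑ k ∈ S, g k := Finset.sum_nonneg fun k _ => (hg k).le
    rw [Real.exp_log (by positivity)]
    field_simp
  set L := ∑ k, R k with hLdef
  have hL : 0 < L := by
    rw [hRsum]
    have : 0 < ∑ k, g k := Finset.sum_pos (fun k _ => hg k) hne
    exact Real.log_pos (by linarith [div_pos this hσ])
  have hσL : σ2 * Real.exp L = σ2 + ∑ k, g k := by rw [hRsum, hexp]
  let h : ℝ → ℝ := fun t => -(L * (σ2 * Real.exp (L * (1 - t))))
  have hcont : Continuous h := by fun_prop
  have hh : ∀ a b, IntervalIntegrable h volume a b := hcont.intervalIntegrable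
  have hneg : ∀ t, h t ≤ 0 := fun t => neg_nonpos.2 (by positivity)
  have hprim : ∀ t, ∫ x in (0:ℝ)..t, h x = σ2 * Real.exp (L * (1 - t)) - (σ2 + ∑ k, g k) := by
    intro t
    have hd : ∀ x ∈ Set.uIcc 0 t,
        HasDerivAt (fun x => σ2 * Real.exp (L * (1 - x))) (h x) x := by
      intro x _
      refine (((((hasDerivAt_id x).const_sub 1).const_mul L).exp).const_mul σ2).congr_deriv ?_
      simp only [h, id]
      ring
    rw [integral_eq_sub_of_hasDerivAt hd (hh _ _)]
    simp [hσL]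
  have hdiv : ∀ S : Finset (Fin K), ∑ k ∈ S, R k / L = (∑ k ∈ S, R k) / L :=
    fun S => (Finset.sum_div _ _ _).symm
  have hone : ∑ k, R k / L = 1 := by rw [hdiv, ← hLdef, div_self hL.ne']
  obtain ⟨u, F, hu, -, hF, hint⟩ := exists_labelling Finset.univ hne (fun k => R k / L)
    (fun k => -g k) (fun k => div_nonneg (hRnn k) hL.le) h hh
    (by
      intro S _
      rw [hdiv, hprim, Finset.sum_neg_distrib]
      have hLS : L * (1 - (∑ k ∈ S, R k) / L) = ∑ k ∈ Sᶜ, R k := by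
        rw [mul_sub, mul_div_cancel₀ _ hL.ne', mul_one, hLdef, ← Finset.sum_add_sum_compl S R]
        ring
      have := mul_le_mul_of_nonneg_left (Real.exp_le_exp.2 (hRsub Sᶜ)) hσ.le
      rw [hexp] at this
      rw [hLS, ← Finset.sum_add_sum_compl S g]
      linarith)
    (by rw [hone, hprim, Finset.sum_neg_distrib]; simp)
  replace hint := fun k => hint k (Finset.mem_univ k)
  rw [hone] at hint
  have hi := intervalIntegrable_indicator_preimage hu hh
  obtain ⟨n, s, hs0, hsn, hsi, hsF⟩ := exists_partition_avoiding F
  let v : ℝ → Fin K → ℝ := fun t k => 1 + (∫ x in (0:ℝ)..t, (u ⁻¹' {k}).indicator h x) / g k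
  have hv0 : ∀ k, v 0 k = 1 := fun k => by simp [v]
  have hv1 : ∀ k, v 1 k = 0 := fun k => by
    simp [v, (hint k).2, neg_div, div_self (hg k).ne']
  have hanti : ∀ k, Antitone fun t => v t k := by
    intro k a b hab
    have hle : ∫ x in a..b, (u ⁻¹' {k}).indicator h x ≤ 0 :=
      by
      have := integral_mono_on hab (hi k a b) (intervalIntegrable_const (c := (0:ℝ)))
        fun x _ => Set.indicator_nonpos (fun x _ => hneg x) x
      simpa using this
    have := integral_add_adjacent_intervals (hi k 0 a) (hi k a b)
    simp only [v]
    have := hg k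
    gcongr
    linarith
  have hsum : ∀ t, σ2 + ∑ k, g k * v t k = σ2 * Real.exp (L * (1 - t)) := by
    intro t
    have h₁ : ∀ k, g k * v t k = g k + ∫ x in (0:ℝ)..t, (u ⁻¹' {k}).indicator h x := by
      intro k
      have := (hg k).ne'
      simp only [v]
      field_simp
    have h₂ : ∀ x, ∑ k, (u ⁻¹' {k}).indicator h x = h x := by
      intro x
      simp [Set.indicator_apply]
    simp only [h₁, Finset.sum_add_distrib]
    rw [← integral_finsetSum fun k _ => hi k 0 t]
    simp only [h₂, hprim]
    ring
  refine ⟨n, s, v, fun t k => (u ⁻¹' {k}).indicator h t / g k, hs0, hsn, hsi, ?_, hv0, hv1,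
    ?_, fun k => (hanti k).antitoneOn _, ?_, ?_, ?_⟩
  · intro k
    exact (continuous_const.add ((continuous_primitive (hi k) 0).div_const _)).continuousOn
  · intro k t ht
    exact ⟨hv1 k ▸ hanti k ht.2, hv0 k ▸ hanti k ht.1⟩
  · intro i hin k t ht
    have hc := continuousAt_indicator_of_eventually_const hcont.continuousAt
      (hF t (hsF i hin t ht).2) k
    refine ((integral_hasDerivAt_right (hi k 0 t) ?_ hc).div_const (g k)).const_add 1
    exact (hcont.measurable.indicator
      (hu (measurableSet_singleton k))).stronglyMeasurable.stronglyMeasurableAtFilter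
  · intro i hin k t ht
    exact ((continuousAt_indicator_of_eventually_const hcont.continuousAt
      (hF t (hsF i hin t ht).2) k).div_const _).continuousWithinAt
  · intro k
    have he : ∀ t, g k * ((u ⁻¹' {k}).indicator h t / g k) / (σ2 + ∑ i, g i * v t i) =
        -L * (u ⁻¹' {k}).indicator (fun _ => (1:ℝ)) t := by
      intro t
      rw [hsum, mul_div_cancel₀ _ (hg k).ne']
      by_cases ht : u t = k
      · have := (Real.exp_pos (L * (1 - t))).ne'
        simp only [Set.indicator_apply, Set.mem_preimage, Set.mem_singleton_iff, ht, if_true, h]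
        field_simp
      · simp [ht]
    simp only [he]
    rw [intervalIntegral.integral_const_mul, (hint k).1]
    field_simp
end
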